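/- Let G be a finite PCA graph and let v, w be distinct non-adjacent vertices of G. If the graph G + vw is a PCA graph but not a PIG graph, the complement of G + vw is not connected, and the complement of G ∖ {v} is connected, then v is adjacent in G + vw to every other vertex of G + vw, and the complement of G is bipartite. -/

import Mathlib

open Classical

noncomputable section

def IsRoundRep (n : ℕ) (r : ZMod n → ℕ) : Prop :=
  (∀ i, r i < n) ∧ (∀ i, r i ≤ r (i + 1) + 1)

def Arrow {n : ℕ} (r : ZMod n → ℕ) (i j : ZMod n) : Prop :=
  ∃ k : ℕ, 1 ≤ k ∧ k ≤ r i ∧ j = i + (k : ZMod n)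

def Fr {n : ℕ} (r : ZMod n → ℕ) (i : ZMod n) : ZMod n := i + (r i : ZMod n)

def Fl {n : ℕ} (r : ZMod n → ℕ) (i : ZMod n) : ZMod n :=
  i - (({j : ZMod n | Arrow r j i}).ncard : ZMod n)

def Nr {n : ℕ} (r : ZMod n → ℕ) (i : ZMod n) : ZMod n :=
  if Arrow r i (i + 1) then i + 1 else i

def Nl {n : ℕ} (r : ZMod n → ℕ) (i : ZMod n) : ZMod n :=
  if Arrow r (i - 1) i then i - 1 else i

def Ur {n : ℕ} (r : ZMod n → ℕ) (i : ZMod n) : ZMod n := Fr r i + 1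

def Ul {n : ℕ} (r : ZMod n → ℕ) (i : ZMod n) : ZMod n := Fl r i - 1

def IsNormal {n : ℕ} (r : ZMod n → ℕ) : Prop :=
  ∀ i j : ZMod n, i ≠ j → ¬(Arrow r i j ∧ Arrow r j i)

def roundGraph {n : ℕ} (r : ZMod n → ℕ) : SimpleGraph (ZMod n) :=
  SimpleGraph.fromRel (Arrow r)

def IsStraight {n : ℕ} (r : ZMod n → ℕ) : Prop := ∃ i, r i = 0

def cyclicRange {n : ℕ} (a b : ZMod n) : Set (ZMod n) :=
  {x | ∃ k : ℕ, k ≤ (b - a).val ∧ x = a + (k : ZMod n)}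

def cyclicRangeCO {n : ℕ} (a b : ZMod n) : Set (ZMod n) := cyclicRange a b \ {b}

def cyclicRangeOC {n : ℕ} (a b : ZMod n) : Set (ZMod n) := cyclicRange a b \ {a}

def cyclicRangeOO {n : ℕ} (a b : ZMod n) : Set (ZMod n) := cyclicRange a b \ {a, b}

def coNbhd {V : Type*} (G : SimpleGraph V) (v : V) : Set V :=
  {w | w ≠ v ∧ ¬ G.Adj v w}

def coNbhdSet {V : Type*} (G : SimpleGraph V) (S : Set V) : Set V :=
  ⋃ v ∈ S, coNbhd G v

def IsBipartite {V : Type*} (G : SimpleGraph V) : Prop :=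
  ∃ S : Set V, ∀ v w, G.Adj v w → (v ∈ S ↔ w ∉ S)

def IsUniversalPt {n : ℕ} (r : ZMod n → ℕ) (i : ZMod n) : Prop :=
  ∀ j, j ≠ i → (roundGraph r).Adj i j

def Compressed {n : ℕ} (r : ZMod n → ℕ) : Prop :=
  ∀ i j : ZMod n, Fl r i = Fl r j → Fr r i = Fr r j → i = j

def IsRoundRepOf {V : Type*} (G : SimpleGraph V) (n : ℕ) (r : ZMod n → ℕ)
    (β : V → ZMod n) : Prop :=
  IsRoundRep n r ∧ IsNormal r ∧ Function.Surjective β ∧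
    ∀ u v : V, u ≠ v → (G.Adj u v ↔ (β u = β v ∨ (roundGraph r).Adj (β u) (β v)))

def IsPCA {V : Type*} (G : SimpleGraph V) : Prop :=
  ∃ n : ℕ, 1 ≤ n ∧ ∃ (r : ZMod n → ℕ) (β : V → ZMod n), IsRoundRepOf G n r β

def IsPIG {V : Type*} (G : SimpleGraph V) : Prop :=
  ∃ n : ℕ, 1 ≤ n ∧ ∃ (r : ZMod n → ℕ) (β : V → ZMod n),
    IsRoundRepOf G n r β ∧ IsStraight r

def IsBlockContigOf {V : Type*} (G : SimpleGraph V) (n : ℕ) (r : ZMod n → ℕ)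
    (β : V → ZMod n) : Prop :=
  IsRoundRepOf G n r β ∧ Compressed r ∧
    {i : ZMod n | IsUniversalPt r i}.Subsingleton ∧ (roundGraph r).Connected

def Disconnectable {n : ℕ} (r : ZMod n → ℕ) (a b : ZMod n) : Prop :=
  b = Fr r a ∧ a = Fl r b

def Connectable {n : ℕ} (r : ZMod n → ℕ) (a b : ZMod n) : Prop :=
  b = Ur r a ∧ a = Ul r b

def addEdge {V : Type*} (G : SimpleGraph V) (v w : V) : SimpleGraph V :=
  G ⊔ SimpleGraph.fromRel (fun x y => x = v ∧ y = w)

def IsCoContigChunk {n : ℕ} (r : ZMod n → ℕ) (S : Set (ZMod n)) : Prop :=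
  (∃ a b : ZMod n, S = cyclicRange a b) ∧
  ∃ X : Set (ZMod n), S ⊆ X ∧
    (∃ C : ((roundGraph r)ᶜ).ConnectedComponent,
      X ∪ coNbhdSet (roundGraph r) X = C.supp) ∧
    X ∩ coNbhdSet (roundGraph r) X = ∅ ∧
    (roundGraph r).IsClique X ∧ (roundGraph r).IsClique (coNbhdSet (roundGraph r) X)

def phi {n : ℕ} (w : ZMod (n + 1)) (k : ZMod n) : ZMod (n + 1) :=
  w + 1 + (k.val : ZMod (n + 1))

def removePt {n : ℕ} (s : ZMod (n + 1) → ℕ) (w : ZMod (n + 1)) (k : ZMod n) : ℕ :=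
  if Arrow s (phi w k) w then s (phi w k) - 1 else s (phi w k)

def Receptive {n : ℕ} (r : ZMod n → ℕ) (Bl Br : ZMod n) : Prop :=
  ∃ (s : ZMod (n + 1) → ℕ) (w : ZMod (n + 1)),
    IsRoundRep (n + 1) s ∧ IsNormal s ∧ (roundGraph s).Connected ∧
    Fl s w ≠ w ∧ Fr s w ≠ w ∧ removePt s w = r ∧
    phi w Bl = Fl s w ∧ phi w Br = Fr s w

def dominoGraph : SimpleGraph (Fin 6) :=
  SimpleGraph.fromRel (fun i j =>
    (i, j) = (0, 1) ∨ (i, j) = (1, 2) ∨ (i, j) = (3, 4) ∨ (i, j) = (4, 5) ∨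
    (i, j) = (0, 3) ∨ (i, j) = (1, 4) ∨ (i, j) = (2, 5))

def pGraph : SimpleGraph (Fin 5) :=
  SimpleGraph.fromRel (fun i j =>
    (i, j) = (0, 1) ∨ (i, j) = (1, 2) ∨ (i, j) = (3, 4) ∨
    (i, j) = (0, 3) ∨ (i, j) = (1, 4))

def AlmostConnectable {V : Type*} {n : ℕ} (r : ZMod n → ℕ) (β : V → ZMod n)
    (a b : ZMod n) : Prop :=
  (∃ v : V, β ⁻¹' {a} = {v}) ∧ (∃ w : V, β ⁻¹' {b} = {w}) ∧
  ∃ (hab : a ≠ b) (C : (((roundGraph r).induce {x : ZMod n | x ≠ b})ᶜ).ConnectedComponent)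
    (D : Set (ZMod n)),
      (⟨a, hab⟩ : {x : ZMod n | x ≠ b}) ∈ C.supp ∧
      D = Subtype.val '' C.supp ∧
      Nonempty ((roundGraph r).induce D ≃g pGraphᶜ) ∧
      Nonempty ((roundGraph r).induce (D ∪ {b}) ≃g dominoGraphᶜ) ∧
      Nonempty ((roundGraph r).induce ((D ∪ {b}) \ {a}) ≃g pGraphᶜ)

theorem le_apply_add_natCast {n : ℕ} {r : ZMod n → ℕ} (hr : IsRoundRep n r) (i : ZMod n)
    (k : ℕ) : r i ≤ r (i + (k : ZMod n)) + k := by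
  induction k with
  | zero => simp
  | succ k ih =>
    have h := hr.2 (i + (k : ZMod n))
    rw [add_assoc] at h
    push_cast
    omega

theorem roundGraph_adj {n : ℕ} {r : ZMod n → ℕ} {i j : ZMod n} :
    (roundGraph r).Adj i j ↔ i ≠ j ∧ (Arrow r i j ∨ Arrow r j i) :=
  SimpleGraph.fromRel_adj _ _ _

/-- Two out-neighbours of a point coincide or are joined by an arrow. -/
theorem eq_or_arrow_of_arrow_left {n : ℕ} {r : ZMod n → ℕ} (hr : IsRoundRep n r)
    {i j l : ZMod n} (hj : Arrow r i j) (hl : Arrow r i l) :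
    j = l ∨ Arrow r j l ∨ Arrow r l j := by
  obtain ⟨a, -, ha, rfl⟩ := hj
  obtain ⟨b, -, hb, rfl⟩ := hl
  have h₁ := le_apply_add_natCast hr i a
  have h₂ := le_apply_add_natCast hr i b
  rcases lt_trichotomy a b with h | rfl | h
  · exact .inr (.inl ⟨b - a, by omega, by omega, by rw [Nat.cast_sub h.le]; ring⟩)
  · exact .inl rfl
  · exact .inr (.inr ⟨a - b, by omega, by omega, by rw [Nat.cast_sub h.le]; ring⟩)

/-- Two in-neighbours of a point coincide or are joined by an arrow. -/
theorem eq_or_arrow_of_arrow_right {n : ℕ} {r : ZMod n → ℕ}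
    {i j l : ZMod n} (hj : Arrow r j i) (hl : Arrow r l i) :
    j = l ∨ Arrow r j l ∨ Arrow r l j := by
  obtain ⟨a, -, ha, hja⟩ := hj
  obtain ⟨b, -, hb, hlb⟩ := hl
  rcases lt_trichotomy a b with h | rfl | h
  · refine .inr (.inr ⟨b - a, by omega, by omega, ?_⟩)
    rw [Nat.cast_sub h.le]
    linear_combination hlb - hja
  · exact .inl (by linear_combination hlb - hja)
  · refine .inr (.inl ⟨a - b, by omega, by omega, ?_⟩)
    rw [Nat.cast_sub h.le]
    linear_combination hja - hlb

/-- A PCA graph with a universal vertex is covered by two cliques. -/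
theorem IsPCA.exists_isClique_isClique_compl {V : Type*} {H : SimpleGraph V} (hH : IsPCA H)
    {v : V} (hv : ∀ u, u ≠ v → H.Adj v u) :
    ∃ S : Set V, H.IsClique S ∧ H.IsClique Sᶜ := by
  obtain ⟨n, -, r, β, hr, -, -, hadj⟩ := hH
  have adj_of {x y : V} (hxy : x ≠ y)
      (h : β x = β y ∨ Arrow r (β x) (β y) ∨ Arrow r (β y) (β x)) : H.Adj x y := by
    rw [hadj x y hxy, roundGraph_adj]
    tauto
  have arrow_of {x : V} (hx : β v ≠ β x) : Arrow r (β v) (β x) ∨ Arrow r (β x) (β v) := by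
    have hxv : x ≠ v := by rintro rfl; exact hx rfl
    have := (hadj v x hxv.symm).1 (hv x hxv)
    rw [roundGraph_adj] at this
    tauto
  refine ⟨{u | β v = β u ∨ Arrow r (β v) (β u)}, ?_, ?_⟩
  · rintro x (hx | hx) y (hy | hy) hxy
    · exact adj_of hxy (.inl (hx.symm.trans hy))
    · exact adj_of hxy (.inr (.inl (hx ▸ hy)))
    · exact adj_of hxy (.inr (.inr (hy ▸ hx)))
    · exact adj_of hxy (eq_or_arrow_of_arrow_left hr hx hy)
  · intro x hx y hy hxy
    simp only [Set.mem_compl_iff, Set.mem_ofPred_eq, not_or] at hx hy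
    exact adj_of hxy (eq_or_arrow_of_arrow_right
      ((arrow_of hx.1).resolve_left hx.2) ((arrow_of hy.1).resolve_left hy.2))

/-- If deleting `v` leaves a connected graph, any neighbour of `v` makes the graph connected. -/
theorem connected_of_connected_induce_ne {V : Type*} {K : SimpleGraph V} {v u : V}
    (hK : (K.induce {x : V | x ≠ v}).Connected) (hvu : K.Adj v u) : K.Connected := by
  have : Nonempty V := ⟨v⟩
  have hreach (x : V) : K.Reachable x u := by
    by_cases hx : x = v
    · exact hx ▸ hvu.reachable
    · exact (hK.preconnected ⟨x, hx⟩ ⟨u, hvu.ne'⟩).map (SimpleGraph.Embedding.induce _).toHom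
  exact ⟨fun x y => (hreach x).trans (hreach y).symm⟩

theorem addEdge_adj {V : Type*} {G : SimpleGraph V} {v w x y : V} :
    (addEdge G v w).Adj x y ↔
      G.Adj x y ∨ x ≠ y ∧ (x = v ∧ y = w ∨ y = v ∧ x = w) := by
  simp [addEdge]

theorem stmt18 {V : Type*} [Fintype V] (G : SimpleGraph V) (hpca : IsPCA G)
    (v w : V) (hvw : v ≠ w) (hnadj : ¬ G.Adj v w)
    (h1 : IsPCA (addEdge G v w)) (h2 : ¬ IsPIG (addEdge G v w))
    (h3 : ¬ ((addEdge G v w)ᶜ).Connected)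
    (h4 : ((G.induce {u : V | u ≠ v})ᶜ).Connected) :
    (∀ u : V, u ≠ v → (addEdge G v w).Adj v u) ∧ IsBipartite (Gᶜ) := by
  have huniv : ∀ u : V, u ≠ v → (addEdge G v w).Adj v u := by
    intro u hu
    by_contra hnot
    refine h3 (connected_of_connected_induce_ne (v := v) (u := u) ?_
      ((SimpleGraph.compl_adj _ _ _).2 ⟨hu.symm, hnot⟩))
    convert h4 using 1
    ext ⟨x, hx⟩ ⟨y, hy⟩
    simp only [Set.mem_ofPred_eq] at hx hy
    simp [SimpleGraph.compl_adj, addEdge_adj, hx, hy]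
  refine ⟨huniv, ?_⟩
  obtain ⟨S, hS, hS'⟩ := h1.exists_isClique_isClique_compl huniv
  have eq_w {u : V} (hu : u ≠ v) (h : ¬ G.Adj v u) : u = w := by
    have := addEdge_adj.1 (huniv u hu)
    tauto
  refine ⟨{u | if u = v then w ∉ S else u ∈ S}, fun x y hxy => ?_⟩
  obtain ⟨hne, hnot⟩ := (SimpleGraph.compl_adj _ _ _).1 hxy
  by_cases hx : x = v
  · subst hx
    obtain rfl := eq_w hne.symm hnot
    simp [hne.symm]
  by_cases hy : y = v
  · subst hy
    obtain rfl := eq_w hne fun h => hnot h.symm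
    simp [hne]
  have hnot' : ¬ (addEdge G v w).Adj x y := by
    rw [addEdge_adj]
    tauto
  simp only [Set.mem_ofPred_eq, hx, hy, if_false]
  exact ⟨fun h h' => hnot' (hS h h' hne),
    fun h => by_contra fun h' => hnot' (hS' h' h hne)⟩
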